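/- Let s₁₂, s₂₃, s₃₄, s₄₅, s₁₅ be nonzero complex numbers and define the dependent Mandelstam invariants s₃₅ = s₁₂ − s₃₄ − s₄₅, s₂₄ = s₁₅ − s₂₃ − s₃₄, s₂₅ = s₃₄ − s₁₅ − s₁₂, s₁₄ = s₂₃ − s₄₅ − s₁₅, s₁₃ = s₄₅ − s₁₂ − s₂₃. Assume s₁₃ ≠ 0, s₁₄ ≠ 0, s₂₅ ≠ 0, and let δ be a complex number with δ² = (s₁₂s₂₅ + s₁₃s₃₅ − s₁₄s₄₅)² − 4 s₁₂ s₁₃ s₂₅ s₃₅. For ε ∈ {+1, −1} define the two solutions z₃^ε = (−s₁₂s₂₅ − s₁₃s₃₅ + s₁₄s₄₅ − εδ)/(2 s₁₃ s₂₅), z₄^ε = (−s₁₂s₂₅ + s₁₃s₃₅ − s₁₄s₄₅ + εδ)/(2 s₁₄ s₂₅). Define P(z₃,z₄) = z₃²(z₄ − 1)² and Q(z₃,z₄) = (s₃₅(z₃ − 1)² + s₂₃ z₃²)(z₃ − z₄)²(s₄₅(z₄ − 1)² + s₂₄ z₄²) + s₃₄[ s₄₅ (z₃ − 1)² z₃²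 (z₄ − 1)² + z₄²( z₃²( s₂₄ (z₃ − 1)² + s₂₃ (z₄ − 1)² ) + s₃₅ (z₃ − 1)² (z₄ − 1)² ) ]. If Q(z₃^+, z₄^+) ≠ 0 and Q(z₃^−, z₄^−) ≠ 0, then P(z₃^+, z₄^+)/Q(z₃^+, z₄^+) + P(z₃^−, z₄^−)/Q(z₃^−, z₄^−) = 1/(s₁₅ s₂₃) + 1/(s₁₂ s₃₄) + 1/(s₁₅ s₃₄) + 1/(s₁₂ s₄₅) + 1/(s₂₃ s₄₅). -/

import Mathlib

/-- On a solution of the scattering equations, `Q` factors through the Jacobian of `f₁, f₂`. -/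
lemma q_factor (s12 s23 s34 s45 s15 a b q : ℂ) (h23 : s23 ≠ 0)
    (f1 : s12 + (s45 - s12 - s23) * a + (s23 - s45 - s15) * b = 0)
    (f2 : s45 * a + (s12 - s34 - s45) * b + (s34 - s15 - s12) * a * b = 0)
    (hq : q = ((s12 - s34 - s45) * (a - 1) ^ 2 + s23 * a ^ 2) * (a - b) ^ 2
          * (s45 * (b - 1) ^ 2 + (s15 - s23 - s34) * b ^ 2)
        + s34 * (s45 * (a - 1) ^ 2 * a ^ 2 * (b - 1) ^ 2
            + b ^ 2 * (a ^ 2 * ((s15 - s23 - s34) * (a - 1) ^ 2 + s23 * (b - 1) ^ 2)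
                + (s12 - s34 - s45) * (a - 1) ^ 2 * (b - 1) ^ 2)))
    (h45 : s45 ≠ 0) (hq0 : q ≠ 0) :
    q = ((s45 - s12 - s23) * ((s12 - s34 - s45) + (s34 - s15 - s12) * a)
      - (s23 - s45 - s15) * (s45 + (s34 - s15 - s12) * b))
      * ((a - 1) * (b - 1) * (a - b) * a * b) := by
  have hb : b ≠ 0 := by
    rintro rfl
    have ha : a = 0 := by
      have : s45 * a = 0 := by linear_combination f2
      simpa [h45] using this
    subst ha
    exact hq0 (by rw [hq]; ring)
  have ha : a - 1 ≠ 0 := by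
    intro h
    have ha : a = 1 := by linear_combination h
    subst ha
    have h' : s23 * (1 - b) = 0 := by linear_combination f2 - f1
    have h2 : b = 1 := by
      rcases mul_eq_zero.1 h' with h | h
      · exact absurd h h23
      · linear_combination -h
    subst h2
    exact hq0 (by rw [hq]; ring)
  have e15 : s15 = (s12 * (1 - a) + (s45 - s23) * (a - b)) / b := by
    field_simp; linear_combination -f1
  have e34 : s34 = (s45 * (a - b) + s12 * b * (1 - a) - s15 * a * b) / (b * (1 - a)) := by
    have : 1 - a ≠ 0 := fun h => ha (by linear_combination -h)
    field_simp; linear_combination -f2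
  have ha' : 1 - a ≠ 0 := fun h => ha (by linear_combination -h)
  rw [hq]
  rw [e15] at e34
  subst e34 e15
  field_simp
  ring

/-- The 5-point scalar φ³ amplitude: the sum of the CHY integrand `P/Q` over
the two explicit solutions of the gauge-fixed scattering equations equals
`1/(s₁₅s₂₃) + 1/(s₁₂s₃₄) + 1/(s₁₅s₃₄) + 1/(s₁₂s₄₅) + 1/(s₂₃s₄₅)`. -/
theorem five_point_phi3_amplitude
    (s₁₂ s₂₃ s₃₄ s₄₅ s₁₅ s₃₅ s₂₄ s₂₅ s₁₄ s₁₃ δ : ℂ)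
    (h12 : s₁₂ ≠ 0) (h23 : s₂₃ ≠ 0) (h34 : s₃₄ ≠ 0) (h45 : s₄₅ ≠ 0)
    (h15 : s₁₅ ≠ 0)
    (hs35 : s₃₅ = s₁₂ - s₃₄ - s₄₅)
    (hs24 : s₂₄ = s₁₅ - s₂₃ - s₃₄)
    (hs25 : s₂₅ = s₃₄ - s₁₅ - s₁₂)
    (hs14 : s₁₄ = s₂₃ - s₄₅ - s₁₅)
    (hs13 : s₁₃ = s₄₅ - s₁₂ - s₂₃)
    (h13 : s₁₃ ≠ 0) (h14 : s₁₄ ≠ 0) (h25 : s₂₅ ≠ 0)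
    (hδ : δ ^ 2 = (s₁₂ * s₂₅ + s₁₃ * s₃₅ - s₁₄ * s₄₅) ^ 2
        - 4 * s₁₂ * s₁₃ * s₂₅ * s₃₅)
    (P Q : ℂ → ℂ → ℂ)
    (hP : ∀ z₃ z₄, P z₃ z₄ = z₃ ^ 2 * (z₄ - 1) ^ 2)
    (hQ : ∀ z₃ z₄, Q z₃ z₄ =
      (s₃₅ * (z₃ - 1) ^ 2 + s₂₃ * z₃ ^ 2) * (z₃ - z₄) ^ 2
          * (s₄₅ * (z₄ - 1) ^ 2 + s₂₄ * z₄ ^ 2)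
        + s₃₄ * (s₄₅ * (z₃ - 1) ^ 2 * z₃ ^ 2 * (z₄ - 1) ^ 2
            + z₄ ^ 2 * (z₃ ^ 2 * (s₂₄ * (z₃ - 1) ^ 2 + s₂₃ * (z₄ - 1) ^ 2)
                + s₃₅ * (z₃ - 1) ^ 2 * (z₄ - 1) ^ 2)))
    (z₃p z₄p z₃m z₄m : ℂ)
    (hz₃p : z₃p = (-(s₁₂ * s₂₅) - s₁₃ * s₃₅ + s₁₄ * s₄₅ - δ)
        / (2 * s₁₃ * s₂₅))
    (hz₄p : z₄p = (-(s₁₂ * s₂₅) + s₁₃ * s₃₅ - s₁₄ * s₄₅ + δ)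
        / (2 * s₁₄ * s₂₅))
    (hz₃m : z₃m = (-(s₁₂ * s₂₅) - s₁₃ * s₃₅ + s₁₄ * s₄₅ + δ)
        / (2 * s₁₃ * s₂₅))
    (hz₄m : z₄m = (-(s₁₂ * s₂₅) + s₁₃ * s₃₅ - s₁₄ * s₄₅ - δ)
        / (2 * s₁₄ * s₂₅))
    (hQp : Q z₃p z₄p ≠ 0) (hQm : Q z₃m z₄m ≠ 0) :
    P z₃p z₄p / Q z₃p z₄p + P z₃m z₄m / Q z₃m z₄m
      = 1 / (s₁₅ * s₂₃) + 1 / (s₁₂ * s₃₄) + 1 / (s₁₅ * s₃₄)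
        + 1 / (s₁₂ * s₄₅) + 1 / (s₂₃ * s₄₅) := by
  rw [hQ] at hQp hQm
  rw [hP, hP, hQ, hQ]
  have p1 : s₁₂ + s₁₃ * z₃p + s₁₄ * z₄p = 0 := by
    rw [hz₃p, hz₄p]; field_simp; ring
  have m1 : s₁₂ + s₁₃ * z₃m + s₁₄ * z₄m = 0 := by
    rw [hz₃m, hz₄m]; field_simp; ring
  have p2 : s₄₅ * z₃p + s₃₅ * z₄p + s₂₅ * z₃p * z₄p = 0 := by
    rw [hz₃p, hz₄p]; field_simp; linear_combination -hδ
  have m2 : s₄₅ * z₃m + s₃₅ * z₄m + s₂₅ * z₃m * z₄m = 0 := by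
    rw [hz₃m, hz₄m]; field_simp; linear_combination -hδ
  have pJ : s₁₃ * (s₃₅ + s₂₅ * z₃p) - s₁₄ * (s₄₅ + s₂₅ * z₄p) = -δ := by
    rw [hz₃p, hz₄p]; field_simp; ring
  have mJ : s₁₃ * (s₃₅ + s₂₅ * z₃m) - s₁₄ * (s₄₅ + s₂₅ * z₄m) = δ := by
    rw [hz₃m, hz₄m]; field_simp; ring
  have nrm4 : z₄p * z₄m = s₁₂ * s₄₅ / (s₁₄ * s₂₅) := by
    rw [hz₄p, hz₄m]; field_simp; linear_combination -hδ
  have nrm3 : z₃p * z₃m = s₁₂ * s₃₅ / (s₁₃ * s₂₅) := by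
    rw [hz₃p, hz₃m]; field_simp; linear_combination -hδ
  have sum3 : z₃p + z₃m = -(s₁₂ * s₂₅ + s₁₃ * s₃₅ - s₁₄ * s₄₅) / (s₁₃ * s₂₅) := by
    rw [hz₃p, hz₃m]; field_simp; ring
  have dif3 : z₃m - z₃p = δ / (s₁₃ * s₂₅) := by
    rw [hz₃p, hz₃m]; field_simp; ring
  have b4p : z₄p = -(s₁₂ + s₁₃ * z₃p) / s₁₄ := by field_simp; linear_combination p1
  have b4m : z₄m = -(s₁₂ + s₁₃ * z₃m) / s₁₄ := by field_simp; linear_combination m1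
  have nrm31 : (z₃p - 1) * (z₃m - 1) = s₁₅ * s₂₃ / (s₁₃ * s₂₅) := by
    have : (z₃p - 1) * (z₃m - 1) = z₃p * z₃m - (z₃p + z₃m) + 1 := by ring
    rw [this, nrm3, sum3]; field_simp; subst hs35 hs25 hs14 hs13; ring
  have nrm34 : (z₃p - z₄p) * (z₃m - z₄m) = s₁₂ * s₁₅ * s₃₄ / (s₁₃ * s₁₄ * s₂₅) := by
    have : (z₃p - z₄p) * (z₃m - z₄m) = ((s₁₃ + s₁₄) ^ 2 * (z₃p * z₃m)
        + (s₁₃ + s₁₄) * s₁₂ * (z₃p + z₃m) + s₁₂ ^ 2) / s₁₄ ^ 2 := by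
      rw [b4p, b4m]; field_simp; ring
    rw [this, nrm3, sum3]; field_simp; subst hs35 hs25 hs14 hs13; ring
  have fp := q_factor s₁₂ s₂₃ s₃₄ s₄₅ s₁₅ z₃p z₄p _ h23
    (by rw [← hs13, ← hs14]; exact p1) (by rw [← hs35, ← hs25]; exact p2) rfl h45
    (by rw [← hs35, ← hs24]; exact hQp)
  have fm := q_factor s₁₂ s₂₃ s₃₄ s₄₅ s₁₅ z₃m z₄m _ h23
    (by rw [← hs13, ← hs14]; exact m1) (by rw [← hs35, ← hs25]; exact m2) rfl h45
    (by rw [← hs35, ← hs24]; exact hQm)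
  rw [← hs13, ← hs14, ← hs35, ← hs25, ← hs24, pJ] at fp
  rw [← hs13, ← hs14, ← hs35, ← hs25, ← hs24, mJ] at fm
  rw [fp] at hQp
  rw [fm] at hQm
  rw [fp, fm]
  clear fp fm
  simp only [ne_eq, mul_eq_zero, not_or, neg_eq_zero] at hQp hQm
  obtain ⟨hd, ⟨⟨⟨k1, k2⟩, k3⟩, k4⟩, k5⟩ := hQp
  obtain ⟨-, ⟨⟨⟨l1, l2⟩, l3⟩, l4⟩, l5⟩ := hQm
  -- rationalise each term with the conjugate factors
  have tp : z₃p ^ 2 * (z₄p - 1) ^ 2 / (-δ * ((z₃p - 1) * (z₄p - 1) * (z₃p - z₄p) * z₃p * z₄p))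
      = -((z₃p * z₃m - z₃p) * (z₄p * z₄m - z₄m) * (z₃m - z₄m))
        / (δ * ((z₃p - 1) * (z₃m - 1)) * ((z₃p - z₄p) * (z₃m - z₄m)) * (z₄p * z₄m)) := by
    field_simp
  have tm : z₃m ^ 2 * (z₄m - 1) ^ 2 / (δ * ((z₃m - 1) * (z₄m - 1) * (z₃m - z₄m) * z₃m * z₄m))
      = ((z₃p * z₃m - z₃m) * (z₄p * z₄m - z₄p) * (z₃p - z₄p))
        / (δ * ((z₃p - 1) * (z₃m - 1)) * ((z₃p - z₄p) * (z₃m - z₄m)) * (z₄p * z₄m)) := by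
    field_simp
  rw [tp, tm, ← add_div, nrm31, nrm34, nrm4, nrm3]
  have num : -((s₁₂ * s₃₅ / (s₁₃ * s₂₅) - z₃p) * (s₁₂ * s₄₅ / (s₁₄ * s₂₅) - z₄m) * (z₃m - z₄m))
      + (s₁₂ * s₃₅ / (s₁₃ * s₂₅) - z₃m) * (s₁₂ * s₄₅ / (s₁₄ * s₂₅) - z₄p) * (z₃p - z₄p)
      = δ * (s₁₅ * s₂₃ / (s₁₃ * s₂₅)) * (s₁₂ * s₁₅ * s₃₄ / (s₁₃ * s₁₄ * s₂₅))
        * (s₁₂ * s₄₅ / (s₁₄ * s₂₅)) * (1 / (s₁₅ * s₂₃) + 1 / (s₁₂ * s₃₄) + 1 / (s₁₅ * s₃₄)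
        + 1 / (s₁₂ * s₄₅) + 1 / (s₂₃ * s₄₅)) := by
    obtain ⟨e, he⟩ : ∃ e, e = δ / (2 * s₁₃ * s₂₅) := ⟨_, rfl⟩
    have hde : δ = 2 * s₁₃ * s₂₅ * e := by rw [he]; field_simp
    obtain ⟨t, ht⟩ : ∃ t, t = -(s₁₂ * s₂₅ + s₁₃ * s₃₅ - s₁₄ * s₄₅) / (2 * s₁₃ * s₂₅) := ⟨_, rfl⟩
    have ep : z₃p = t - e := by rw [hz₃p, ht, he]; field_simp; ring
    have em : z₃m = t + e := by rw [hz₃m, ht, he]; field_simp; ring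
    have e2 : e ^ 2 = t ^ 2 - s₁₂ * s₃₅ / (s₁₃ * s₂₅) := by
      rw [← nrm3, ep, em]; ring
    rw [b4p, b4m, ep, em, hde]
    have key : ∀ n m r c : ℂ, 
        -((n - (t - e)) * (m - (c - r * (t + e))) * ((t + e) - (c - r * (t + e))))
        + (n - (t + e)) * (m - (c - r * (t - e))) * ((t - e) - (c - r * (t - e)))
        = -2 * e * ((m - c + r * t) * ((1 + r) * t - c) + (n - t) * (r * ((1 + r) * t - c)
          + (1 + r) * (m - c + r * t)) + r * (1 + r) * e ^ 2) := by
      intros; ring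
    have c1 : ∀ x, -(s₁₂ + s₁₃ * x) / s₁₄ = -s₁₂ / s₁₄ - s₁₃ / s₁₄ * x := by
      intro x; ring
    rw [c1, c1, key, e2, ht]
    field_simp
    subst hs35 hs25 hs14 hs13
    ring
  rw [num]
  field_simp
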